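/- Let λ_1, ..., λ_N be real numbers with |λ_k − λ_ℓ| ≥ 1 for k ≠ ℓ, let u_1, ..., u_N be complex numbers of modulus 1, let I = [-L/2, L/2] with L > 0, and set f(t) = ∑_{k=1}^N u_k e^{-2πi λ_k t}. Then ∫_I |f(t)|² dt ≥ (L − 1) N. -/

import Mathlib

open MeasureTheory intervalIntegral

open scoped ComplexConjugate

/-- One half of the sum of the inverse squared gaps: the points above `lam l`. -/
lemma sum_inv_sq_gap_above_le {ι : Type*} [Fintype ι] {lam : ι → ℝ}
    (hsep : ∀ k l, k ≠ l → 1 ≤ |lam k - lam l|) (l : ι) :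
    ∑ k with lam l < lam k, ((lam k - lam l)⁻¹) ^ 2 ≤ Real.pi ^ 2 / 6 := by
  classical
  set s : Finset ι := {k | lam l < lam k} with hs
  have hpos : ∀ k ∈ s, 0 < lam k - lam l := fun k hk => by
    have : lam l < lam k := by simpa [hs] using hk
    linarith
  have hinj : Set.InjOn (fun k => ⌊lam k - lam l⌋₊) s := by
    intro a ha b hb hab
    by_contra hne
    have h1 := hsep a b hne
    have ha1 := Nat.floor_le (hpos a ha).le
    have hb1 := Nat.floor_le (hpos b hb).le
    have ha2 := Nat.lt_floor_add_one (lam a - lam l)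
    have hb2 := Nat.lt_floor_add_one (lam b - lam l)
    simp only at hab
    rw [hab] at ha1 ha2
    have : |lam a - lam b| < 1 := abs_lt.2 ⟨by linarith, by linarith⟩
    linarith
  calc ∑ k ∈ s, ((lam k - lam l)⁻¹) ^ 2
      ≤ ∑ k ∈ s, (1 : ℝ) / (⌊lam k - lam l⌋₊ : ℝ) ^ 2 := by
        refine Finset.sum_le_sum fun k hk => ?_
        have hp := hpos k hk
        have h1 : 1 ≤ lam k - lam l := by
          have := hsep k l (by rintro rfl; simp at hp)
          rwa [abs_of_pos hp] at this
        have h2 : (0 : ℝ) < ⌊lam k - lam l⌋₊ := by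
          exact_mod_cast Nat.floor_pos.2 h1
        rw [inv_pow, ← one_div]
        gcongr
        exact Nat.floor_le hp.le
    _ = ∑ n ∈ s.image (fun k => ⌊lam k - lam l⌋₊), (1 : ℝ) / (n : ℝ) ^ 2 :=
        (Finset.sum_image (f := fun n : ℕ => (1 : ℝ) / (n : ℝ) ^ 2) hinj).symm
    _ ≤ Real.pi ^ 2 / 6 := sum_le_hasSum _ (fun _ _ => by positivity) hasSum_zeta_two

lemma sum_inv_sq_gap_le {ι : Type*} [Fintype ι] {lam : ι → ℝ}
    (hsep : ∀ k l, k ≠ l → 1 ≤ |lam k - lam l|) (l : ι) :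
    ∑ k, ((lam k - lam l)⁻¹) ^ 2 ≤ Real.pi ^ 2 / 3 := by
  classical
  have h1 := sum_inv_sq_gap_above_le hsep l
  have h2 := sum_inv_sq_gap_above_le (lam := fun k => -lam k)
    (fun a b hab => by
      rw [neg_sub_neg, abs_sub_comm]
      exact hsep a b hab) l
  have h3 : ∑ k, ((lam k - lam l)⁻¹) ^ 2
      = ∑ k with lam l < lam k, ((lam k - lam l)⁻¹) ^ 2
        + ∑ k with -lam l < -lam k, ((-lam k - -lam l)⁻¹) ^ 2 := by
    rw [Finset.sum_filter, Finset.sum_filter, ← Finset.sum_add_distrib]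
    refine Finset.sum_congr rfl fun k _ => ?_
    rcases lt_trichotomy (lam l) (lam k) with h | h | h
    · simp [h, not_lt.2 h.le]
    · simp [h]
    · rw [if_neg (not_lt.2 h.le), if_pos (neg_lt_neg h), zero_add, inv_pow, inv_pow]
      congr 1
      ring
  rw [h3]
  linarith

/-- The partial fraction identity behind Hilbert's inequality. -/
lemma inv_sub_mul_inv_sub {ι : Type*} [DecidableEq ι] {lam : ι → ℝ}
    (hinj : Function.Injective lam) (k l m : ι) :
    (lam k - lam l)⁻¹ * (lam k - lam m)⁻¹
      = (lam l - lam m)⁻¹ * ((lam k - lam l)⁻¹ - (lam k - lam m)⁻¹)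
        + (if k = l then ((lam l - lam m)⁻¹) ^ 2 else 0)
        + (if k = m then ((lam l - lam m)⁻¹) ^ 2 else 0)
        + (if l = m then ((lam k - lam l)⁻¹) ^ 2 else 0) := by
  by_cases hlm : l = m
  · subst hlm
    simp only [sub_self, inv_zero, zero_mul, ne_eq, OfNat.ofNat_ne_zero, not_false_eq_true,
      zero_pow, ite_self, if_true, add_zero, zero_add]
    rw [sq]
  by_cases hkl : k = l
  · subst hkl
    simp only [hlm, sub_self, inv_zero, if_true, if_false]
    ring
  by_cases hkm : k = m
  · subst hkm
    have : (lam k - lam l)⁻¹ = -(lam l - lam k)⁻¹ := by rw [← inv_neg, neg_sub]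
    simp only [hlm, hkl, this, sub_self, inv_zero, if_true, if_false]
    ring
  have h1 := sub_ne_zero.2 (hinj.ne hlm)
  have h2 := sub_ne_zero.2 (hinj.ne hkl)
  have h3 := sub_ne_zero.2 (hinj.ne hkm)
  simp only [hlm, hkl, hkm, if_false, add_zero]
  field_simp
  ring

/-- Eigenvalues of the matrix `I / (lam k - lam l)` are at most `π` in absolute value. -/
lemma sq_eigenvalue_hilbert_le {ι : Type*} [Fintype ι] {lam : ι → ℝ}
    (hsep : ∀ k l, k ≠ l → 1 ≤ |lam k - lam l|) (x : ι → ℂ) (μ : ℝ)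
    (hx : ∀ k, ∑ l, (((lam k - lam l)⁻¹ : ℝ) : ℂ) * x l = -Complex.I * μ * x k) :
    μ ^ 2 * ∑ k, ‖x k‖ ^ 2 ≤ Real.pi ^ 2 * ∑ k, ‖x k‖ ^ 2 := by
  classical
  have hinj : Function.Injective lam := fun a b hab => by
    by_contra hne
    have := hsep a b hne
    rw [hab, sub_self, abs_zero] at this
    linarith
  set h : ι → ι → ℝ := fun k l => (lam k - lam l)⁻¹ with hh
  have hanti : ∀ k l, h k l = -h l k := fun k l => by
    simp only [hh]
    rw [← inv_neg, neg_sub]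
  have hx' : ∀ k, ∑ l, (h k l : ℂ) * x l = -Complex.I * μ * x k := hx
  have hxc : ∀ k, ∑ l, (h k l : ℂ) * conj (x l) = Complex.I * μ * conj (x k) := fun k => by
    have := congrArg conj (hx' k)
    simpa [map_sum] using this
  set S : ι → ℝ := fun l => ∑ k, h k l with hS
  have hgram : ∀ l m, ∑ k, h k l * h k m = h l m * (S l - S m) + 2 * (h l m) ^ 2
      + (if l = m then ∑ k, (h k l) ^ 2 else 0) := fun l m => by
    rw [Finset.sum_congr rfl fun k _ => inv_sub_mul_inv_sub hinj k l m]
    simp only [Finset.sum_add_distrib, ← Finset.mul_sum, Finset.sum_sub_distrib,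
      Finset.sum_ite_eq', Finset.mem_univ, if_true, hS, hh]
    split_ifs <;> simp <;> ring
  have hnorm : ((μ ^ 2 * ∑ k, ‖x k‖ ^ 2 : ℝ) : ℂ)
      = ∑ l, ∑ m, ((∑ k, h k l * h k m : ℝ) : ℂ) * (x l * conj (x m)) := by
    have e1 : ((μ ^ 2 * ∑ k, ‖x k‖ ^ 2 : ℝ) : ℂ)
        = ∑ k, (∑ l, (h k l : ℂ) * x l) * (∑ m, (h k m : ℂ) * conj (x m)) := by
      push_cast
      rw [Finset.mul_sum]
      refine Finset.sum_congr rfl fun k _ => ?_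
      rw [hx', hxc, ← Complex.mul_conj']
      linear_combination (μ ^ 2 * x k * conj (x k) : ℂ) * Complex.I_sq
    rw [e1]
    simp only [Finset.sum_mul_sum]
    simp only [Complex.ofReal_sum, Finset.sum_mul, Complex.ofReal_mul]
    rw [Finset.sum_comm]
    refine Finset.sum_congr rfl fun l _ => ?_
    rw [Finset.sum_comm]
    refine Finset.sum_congr rfl fun m _ => Finset.sum_congr rfl fun k _ => ?_
    ring
  have hSl : ∑ l, ∑ m, (h l m * S l : ℂ) * (x l * conj (x m))
      = ∑ l, Complex.I * μ * S l * (x l * conj (x l)) := by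
    refine Finset.sum_congr rfl fun l _ => ?_
    calc _ = S l * x l * ∑ m, (h l m : ℂ) * conj (x m) := by
          rw [Finset.mul_sum]
          exact Finset.sum_congr rfl fun m _ => by ring
      _ = _ := by rw [hxc]; ring
  have hSm : ∑ l, ∑ m, (h l m * S m : ℂ) * (x l * conj (x m))
      = ∑ l, Complex.I * μ * S l * (x l * conj (x l)) := by
    rw [Finset.sum_comm]
    refine Finset.sum_congr rfl fun m _ => ?_
    calc _ = -(S m * conj (x m) * ∑ l, (h m l : ℂ) * x l) := by
          rw [Finset.mul_sum, ← Finset.sum_neg_distrib]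
          refine Finset.sum_congr rfl fun l _ => ?_
          rw [hanti l m]
          push_cast
          ring
      _ = _ := by rw [hx']; ring
  have hexp : ((μ ^ 2 * ∑ k, ‖x k‖ ^ 2 : ℝ) : ℂ)
      = ∑ l, ∑ m, ((2 * (h l m) ^ 2 : ℝ) : ℂ) * (x l * conj (x m))
        + ∑ l, ((∑ k, (h k l) ^ 2 : ℝ) : ℂ) * (x l * conj (x l)) := by
    have e2 : ∀ l m, ((∑ k, h k l * h k m : ℝ) : ℂ) * (x l * conj (x m))
        = (h l m * S l : ℂ) * (x l * conj (x m)) - (h l m * S m : ℂ) * (x l * conj (x m))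
          + ((2 * (h l m) ^ 2 : ℝ) : ℂ) * (x l * conj (x m))
          + (if l = m then ((∑ k, (h k l) ^ 2 : ℝ) : ℂ) * (x l * conj (x m)) else 0) := by
      intro l m
      rw [hgram]
      split_ifs <;> push_cast <;> ring
    rw [hnorm]
    simp only [e2, Finset.sum_add_distrib, Finset.sum_sub_distrib, hSl, hSm, sub_self, zero_add,
      Finset.sum_ite_eq, Finset.mem_univ, if_true]
  have hre : μ ^ 2 * ∑ k, ‖x k‖ ^ 2
      = ∑ l, ∑ m, 2 * (h l m) ^ 2 * (x l * conj (x m)).re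
        + ∑ l, (∑ k, (h k l) ^ 2) * ‖x l‖ ^ 2 := by
    have := congrArg Complex.re hexp
    rw [Complex.ofReal_re, Complex.add_re, Complex.re_sum, Complex.re_sum] at this
    simp only [Complex.re_sum, Complex.re_ofReal_mul] at this
    rw [this]
    congr 1
    refine Finset.sum_congr rfl fun l _ => ?_
    rw [Complex.mul_conj, Complex.ofReal_re, Complex.normSq_eq_norm_sq]
  have hprod : ∀ a b : ℂ, 2 * (a * conj b).re ≤ ‖a‖ ^ 2 + ‖b‖ ^ 2 := fun a b => by
    have h1 : (a * conj b).re ≤ ‖a‖ * ‖b‖ := by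
      simpa using Complex.re_le_norm (a * conj b)
    nlinarith [sq_nonneg (‖a‖ - ‖b‖)]
  have hsq : ∀ k l, (h k l) ^ 2 = (h l k) ^ 2 := fun k l => by rw [hanti, neg_sq]
  have hoff : ∑ l, ∑ m, 2 * (h l m) ^ 2 * (x l * conj (x m)).re
      ≤ 2 * ∑ l, (∑ k, (h k l) ^ 2) * ‖x l‖ ^ 2 := by
    calc _ ≤ ∑ l, ∑ m, ((h l m) ^ 2 * ‖x l‖ ^ 2 + (h l m) ^ 2 * ‖x m‖ ^ 2) := by
          refine Finset.sum_le_sum fun l _ => Finset.sum_le_sum fun m _ => ?_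
          have := mul_le_mul_of_nonneg_left (hprod (x l) (x m)) (sq_nonneg (h l m))
          linarith
      _ = _ := by
          simp only [Finset.sum_add_distrib]
          rw [two_mul]
          congr 1
          · refine Finset.sum_congr rfl fun l _ => ?_
            rw [← Finset.sum_mul]
            simp only [hsq l]
          · rw [Finset.sum_comm]
            simp only [Finset.sum_mul]
  have hdiag : ∑ l, (∑ k, (h k l) ^ 2) * ‖x l‖ ^ 2 ≤ Real.pi ^ 2 / 3 * ∑ l, ‖x l‖ ^ 2 := by
    rw [Finset.mul_sum]
    exact Finset.sum_le_sum fun l _ =>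
      mul_le_mul_of_nonneg_right (sum_inv_sq_gap_le hsep l) (sq_nonneg _)
  linarith

open scoped ComplexOrder in
/-- **Hilbert's inequality** (lower bound) for `1`-separated real frequencies. -/
lemma hilbert_inequality_lower {ι : Type*} [Fintype ι] {lam : ι → ℝ}
    (hsep : ∀ k l, k ≠ l → 1 ≤ |lam k - lam l|) (a : ι → ℂ) :
    -(Real.pi * ∑ k, ‖a k‖ ^ 2)
      ≤ (∑ k, ∑ l, a k * conj (a l) * (Complex.I * ((lam k - lam l)⁻¹ : ℝ))).re := by
  classical
  set B : Matrix ι ι ℂ := Matrix.of fun k l =>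
    (if k = l then (Real.pi : ℂ) else 0) - Complex.I * ((lam k - lam l)⁻¹ : ℝ) with hB
  have hmul : ∀ (x : ι → ℂ) k, (B.mulVec x) k
      = Real.pi * x k - Complex.I * ∑ l, (((lam k - lam l)⁻¹ : ℝ) : ℂ) * x l := by
    intro x k
    simp [Matrix.mulVec, dotProduct, hB, sub_mul, Finset.sum_sub_distrib, Finset.mul_sum,
      mul_assoc]
  have hherm : B.IsHermitian := by
    ext k l
    have : ((lam l - lam k)⁻¹ : ℝ) = -(lam k - lam l)⁻¹ := by rw [← inv_neg, neg_sub]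
    simp only [Matrix.conjTranspose_apply, hB, Matrix.of_apply, this]
    by_cases hkl : k = l
    · simp [hkl]
    · simp [hkl, Ne.symm hkl]
  have hpsd : B.PosSemidef := by
    rw [hherm.posSemidef_iff_eigenvalues_nonneg]
    intro i
    have hev := hherm.mulVec_eigenvectorBasis i
    set x : ι → ℂ := ⇑(hherm.eigenvectorBasis i) with hxdef
    have hxnorm : ∑ k, ‖x k‖ ^ 2 = 1 := by
      rw [hxdef, ← EuclideanSpace.norm_sq_eq, hherm.eigenvectorBasis.orthonormal.1 i, one_pow]
    have hle := sq_eigenvalue_hilbert_le hsep x (Real.pi - hherm.eigenvalues i) (fun k => by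
      have h1 := congrFun hev k
      rw [hmul, Pi.smul_apply, Complex.real_smul] at h1
      push_cast at h1 ⊢
      linear_combination Complex.I * h1 +
        (∑ l, ((lam k - lam l)⁻¹ : ℂ) * x l) * Complex.I_sq)
    rw [hxnorm, mul_one, mul_one] at hle
    have := (abs_le.1 (abs_le_of_sq_le_sq hle Real.pi_pos.le)).2
    simp only [Pi.zero_apply]
    linarith
  have hq := hpsd.re_dotProduct_nonneg a
  have heq : star a ⬝ᵥ (B.mulVec a) = ((Real.pi * ∑ k, ‖a k‖ ^ 2 : ℝ) : ℂ)
      + ∑ k, ∑ l, a k * conj (a l) * (Complex.I * ((lam k - lam l)⁻¹ : ℝ)) := by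
    simp only [dotProduct, hmul, mul_sub, Finset.sum_sub_distrib]
    rw [sub_eq_add_neg]
    congr 1
    · push_cast
      rw [Finset.mul_sum]
      refine Finset.sum_congr rfl fun k _ => ?_
      rw [← Complex.mul_conj', Pi.star_apply, Complex.star_def]
      ring
    · rw [Finset.sum_comm, ← Finset.sum_neg_distrib]
      refine Finset.sum_congr rfl fun k _ => ?_
      rw [Finset.mul_sum, Finset.mul_sum, ← Finset.sum_neg_distrib]
      refine Finset.sum_congr rfl fun l _ => ?_
      have : ((lam l - lam k)⁻¹ : ℝ) = -(lam k - lam l)⁻¹ := by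
        rw [← inv_neg, neg_sub]
      rw [this, Pi.star_apply, Complex.star_def]
      push_cast
      ring
  rw [heq] at hq
  simp only [RCLike.re_to_complex, Complex.add_re, Complex.ofReal_re] at hq
  linarith

/-- **Hilbert's inequality** (upper bound) for `1`-separated real frequencies. -/
lemma hilbert_inequality_upper {ι : Type*} [Fintype ι] {lam : ι → ℝ}
    (hsep : ∀ k l, k ≠ l → 1 ≤ |lam k - lam l|) (a : ι → ℂ) :
    (∑ k, ∑ l, a k * conj (a l) * (Complex.I * ((lam k - lam l)⁻¹ : ℝ))).re
      ≤ Real.pi * ∑ k, ‖a k‖ ^ 2 := by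
  have h := hilbert_inequality_lower (lam := fun k => -lam k)
    (fun k l hkl => by
      rw [neg_sub_neg, abs_sub_comm]
      exact hsep k l hkl) a
  have hneg : ∀ k l, ((-lam k - -lam l)⁻¹ : ℝ) = -(lam k - lam l)⁻¹ := fun k l => by
    rw [← inv_neg]; congr 1; ring
  simp only [hneg, Complex.ofReal_neg, mul_neg, Finset.sum_neg_distrib, Complex.neg_re] at h
  linarith

lemma integral_exp_frequency (d L : ℝ) :
    ∫ t in (-(L/2))..(L/2), Complex.exp (-(2 * Real.pi * d * Complex.I) * (t : ℂ))
      = (if d = 0 then (L : ℂ) else 0)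
        + Complex.I * (d⁻¹ : ℝ) / (2 * Real.pi)
          * (Complex.exp (-(Real.pi * L * d * Complex.I))
            - Complex.exp (Real.pi * L * d * Complex.I)) := by
  by_cases hd : d = 0
  · simp [hd]
  have hd' : (d : ℂ) ≠ 0 := by exact_mod_cast hd
  have hpi : (Real.pi : ℂ) ≠ 0 := by exact_mod_cast Real.pi_ne_zero
  have hc : -(2 * Real.pi * d * Complex.I) ≠ 0 := by simp [hd, Real.pi_ne_zero]
  rw [integral_exp_mul_complex hc, if_neg hd, zero_add]
  have e1 : -(2 * Real.pi * d * Complex.I) * ((L / 2 : ℝ) : ℂ)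
      = -(Real.pi * L * d * Complex.I) := by push_cast; ring
  have e2 : -(2 * Real.pi * d * Complex.I) * ((-(L / 2) : ℝ) : ℂ)
      = Real.pi * L * d * Complex.I := by push_cast; ring
  rw [e1, e2, div_eq_iff hc]
  push_cast
  field_simp
  linear_combination (Complex.exp (-(Real.pi * L * d * Complex.I))
    - Complex.exp (Real.pi * L * d * Complex.I)) * Complex.I_sq

/-- Lower L² bound over a finite interval for a unimodular exponential sum with
1-separated frequencies. -/
theorem exp_sum_L2_lower (N : ℕ) (lam : Fin N → ℝ)
    (hsep : ∀ k l : Fin N, k ≠ l → 1 ≤ |lam k - lam l|)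
    (u : Fin N → ℂ) (hu : ∀ k, ‖u k‖ = 1) (L : ℝ) (hL : 0 < L) :
    (L - 1) * N ≤
      ∫ t in (-(L/2))..(L/2),
        ‖∑ k : Fin N, u k * Complex.exp (-(((2 * Real.pi * lam k * t : ℝ) : ℂ) * Complex.I))‖ ^ 2 := by
  have hconj : ∀ s : ℝ, conj (Complex.exp (-((s : ℂ) * Complex.I)))
      = Complex.exp ((s : ℂ) * Complex.I) := fun s => by
    rw [← Complex.exp_conj]; simp
  have hconj' : ∀ s : ℝ, conj (Complex.exp ((s : ℂ) * Complex.I))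
      = Complex.exp (-((s : ℂ) * Complex.I)) := fun s => by
    rw [← Complex.exp_conj]; simp
  have hsq : ∀ t : ℝ, ((‖∑ k : Fin N,
      u k * Complex.exp (-(((2 * Real.pi * lam k * t : ℝ) : ℂ) * Complex.I))‖ ^ 2 : ℝ) : ℂ)
      = ∑ k, ∑ l, u k * conj (u l)
        * Complex.exp (-(2 * Real.pi * (lam k - lam l : ℝ) * Complex.I) * (t : ℂ)) := by
    intro t
    rw [Complex.ofReal_pow]
    rw [← Complex.mul_conj', map_sum, Finset.sum_mul_sum]
    refine Finset.sum_congr rfl fun k _ => Finset.sum_congr rfl fun l _ => ?_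
    rw [map_mul, hconj, mul_mul_mul_comm, ← Complex.exp_add]
    congr 2
    push_cast
    ring
  set v : Fin N → ℂ := fun k =>
    u k * Complex.exp (-(((Real.pi * L * lam k : ℝ) : ℂ) * Complex.I)) with hv
  set w : Fin N → ℂ := fun k =>
    u k * Complex.exp (((Real.pi * L * lam k : ℝ) : ℂ) * Complex.I) with hw
  have hvn : ∑ k, ‖v k‖ ^ 2 = N := by
    simp [hv, hu, Complex.norm_exp]
  have hwn : ∑ k, ‖w k‖ ^ 2 = N := by
    simp [hw, hu, Complex.norm_exp]
  have hvv : ∀ k l, v k * conj (v l) = u k * conj (u l)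
      * Complex.exp (-(Real.pi * L * (lam k - lam l : ℝ) * Complex.I)) := fun k l => by
    simp only [hv]
    rw [map_mul, hconj, mul_mul_mul_comm, ← Complex.exp_add]
    congr 2
    push_cast
    ring
  have hww : ∀ k l, w k * conj (w l) = u k * conj (u l)
      * Complex.exp (Real.pi * L * (lam k - lam l : ℝ) * Complex.I) := fun k l => by
    simp only [hw]
    rw [map_mul, hconj', mul_mul_mul_comm, ← Complex.exp_add]
    congr 2
    push_cast
    ring
  have hzero : ∀ k l, lam k - lam l = 0 ↔ k = l := fun k l => by
    refine ⟨fun h => ?_, fun h => by rw [h, sub_self]⟩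
    by_contra hne
    have := hsep k l hne
    rw [h, abs_zero] at this
    linarith
  have hint : ((∫ t in (-(L/2))..(L/2), ‖∑ k : Fin N,
      u k * Complex.exp (-(((2 * Real.pi * lam k * t : ℝ) : ℂ) * Complex.I))‖ ^ 2 : ℝ) : ℂ)
      = ((L * N : ℝ) : ℂ) + ((1 / (2 * Real.pi) : ℝ) : ℂ)
        * (∑ k, ∑ l, v k * conj (v l) * (Complex.I * ((lam k - lam l)⁻¹ : ℝ))
          - ∑ k, ∑ l, w k * conj (w l) * (Complex.I * ((lam k - lam l)⁻¹ : ℝ))) := by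
    rw [← intervalIntegral.integral_ofReal]
    simp only [hsq]
    rw [intervalIntegral.integral_finsetSum fun k _ =>
      Continuous.intervalIntegrable (by fun_prop) _ _]
    have hterm : ∀ k, ∫ t in (-(L/2))..(L/2), ∑ l, u k * conj (u l)
        * Complex.exp (-(2 * Real.pi * (lam k - lam l : ℝ) * Complex.I) * (t : ℂ))
        = L + ((1 / (2 * Real.pi) : ℝ) : ℂ)
        * (∑ l, v k * conj (v l) * (Complex.I * ((lam k - lam l)⁻¹ : ℝ))
          - ∑ l, w k * conj (w l) * (Complex.I * ((lam k - lam l)⁻¹ : ℝ))) := by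
      intro k
      rw [intervalIntegral.integral_finsetSum fun l _ =>
        Continuous.intervalIntegrable (by fun_prop) _ _]
      have hL' : (L : ℂ) = ∑ l, if k = l then u k * conj (u l) * L else 0 := by
        simp [Complex.mul_conj', hu]
      rw [← Finset.sum_sub_distrib, Finset.mul_sum]
      conv_rhs => rw [hL']
      rw [← Finset.sum_add_distrib]
      refine Finset.sum_congr rfl fun l _ => ?_
      rw [intervalIntegral.integral_const_mul, integral_exp_frequency, hvv, hww]
      simp only [hzero]
      push_cast
      split_ifs <;> ring
    simp only [hterm, Finset.sum_add_distrib, ← Finset.mul_sum, Finset.sum_sub_distrib]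
    simp [mul_comm]
  have hre := congrArg Complex.re hint
  rw [Complex.ofReal_re, Complex.add_re, Complex.ofReal_re, Complex.re_ofReal_mul,
    Complex.sub_re] at hre
  have h1 := hilbert_inequality_lower hsep v
  have h2 := hilbert_inequality_upper hsep w
  rw [hvn] at h1
  rw [hwn] at h2
  rw [hre]
  have h3 := mul_le_mul_of_nonneg_left (sub_le_sub h1 h2)
    (by positivity : 0 ≤ 1 / (2 * Real.pi))
  have h4 : 1 / (2 * Real.pi) * (-(Real.pi * N) - Real.pi * N) = -(N : ℝ) := by
    field_simp
    ring
  linarith
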